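/- Let ℓ be a tuple of nonnegative integers indexed by the Dirichlet characters modulo q with |ℓ| = k. Then there is a constant C depending only on k such that, uniformly for all complex s with Re s ≥ 1/2 and all real X > q², one has [𝓟_X^ℓ(s)]^{−1} = 𝓠_X^ℓ(s)·(1 + E) with |E| ≤ C/log X; equivalently, 𝓟_X^ℓ(s)·𝓠_X^ℓ(s) = 1 + O_k(1/log X). -/

import Mathlib

open Complex Filter MeasureTheory Finset HurwitzZeta
open scoped ArithmeticFunction Real Classical

noncomputable section

/-- The finite set of primes `p ≤ X`. -/
def primesUpTo (X : ℝ) : Finset ℕ :=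
  (Finset.range (Nat.floor X + 1)).filter (fun p => p.Prime ∧ (p : ℝ) ≤ X)

/-- The finite set of naturals `n ≤ X`. -/
def natsUpTo (X : ℝ) : Finset ℕ :=
  (Finset.range (Nat.floor X + 1)).filter (fun n => (n : ℝ) ≤ X)

/-- Truncated Euler product `P_X(s,χ)`, defined via the primitive character `χ*` inducing `χ`:
`P_X(s,χ) = ∏_{p ∣ q} (1 - χ*(p) p^{-s}) · exp(∑_{n ≤ X} χ*(n) Λ(n) / (n^s log n))`. -/
def PX {q : ℕ} (X : ℝ) (χ : DirichletCharacter ℂ q) (s : ℂ) : ℂ :=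
  (∏ p ∈ q.primeFactors, (1 - χ.primitiveCharacter ((p : ℕ) : ZMod χ.conductor) * (p : ℂ) ^ (-s))) *
    Complex.exp (∑ n ∈ natsUpTo X,
      χ.primitiveCharacter ((n : ℕ) : ZMod χ.conductor) * (Λ n : ℂ) / ((n : ℂ) ^ s * (Real.log n : ℂ)))

/-- `𝓟_X^ℓ(s) = ∏_χ P_X(s,χ)^{ℓ_χ}`. -/
def PXl {q : ℕ} (X : ℝ) (ℓ : DirichletCharacter ℂ q → ℕ) (s : ℂ) : ℂ :=
  ∏ χ : DirichletCharacter ℂ q, (PX X χ s) ^ (ℓ χ)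

/-- A Dirichlet character as an arithmetic function. -/
def chiArith {q : ℕ} (χ : DirichletCharacter ℂ q) : ArithmeticFunction ℂ :=
  ⟨fun n => if n = 0 then 0 else χ ((n : ℕ) : ZMod q), by simp⟩

/-- `d_ℓ`, the coefficients of the Dirichlet series of `𝓛^ℓ(s) = ∏_χ L(s,χ)^{ℓ_χ}`,
i.e. the Dirichlet convolution product `∏_χ χ^{*ℓ_χ}`. -/
def dcoef {q : ℕ} (ℓ : DirichletCharacter ℂ q → ℕ) : ArithmeticFunction ℂ :=
  ∏ χ : DirichletCharacter ℂ q, (chiArith χ) ^ (ℓ χ)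

/-- `P*_X(s,χ) = ∏_{p ≤ X}(1 − χ(p)p^{−s})^{−1} · ∏_{√X < p ≤ X}(1 + χ(p)²/(2p^{2s}))^{−1}`. -/
def PstarX {q : ℕ} (X : ℝ) (χ : DirichletCharacter ℂ q) (s : ℂ) : ℂ :=
  ((primesUpTo X).prod (fun p : ℕ => (1 - χ ((p : ℕ) : ZMod q) * (p : ℂ) ^ (-s))⁻¹)) *
    ((primesUpTo X).filter (fun p : ℕ => Real.sqrt X < (p : ℝ))).prod
      (fun p : ℕ => (1 + χ ((p : ℕ) : ZMod q) ^ 2 / (2 * (p : ℂ) ^ (2 * s)))⁻¹)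

/-- `𝓟*_X^ℓ(s) = ∏_χ P*_X(s,χ)^{ℓ_χ}`. -/
def PstarXl {q : ℕ} (X : ℝ) (ℓ : DirichletCharacter ℂ q → ℕ) (s : ℂ) : ℂ :=
  ∏ χ : DirichletCharacter ℂ q, (PstarX X χ s) ^ (ℓ χ)

/-- `Q_X(s,χ) = ∏_{p ≤ √X}(1 − χ(p)p^{−s}) · ∏_{√X < p ≤ X}(1 − χ(p)p^{−s} + χ(p)²/(2p^{2s}))`. -/
def QX {q : ℕ} (X : ℝ) (χ : DirichletCharacter ℂ q) (s : ℂ) : ℂ :=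
  (((primesUpTo X).filter (fun p : ℕ => (p : ℝ) ≤ Real.sqrt X)).prod
      (fun p : ℕ => 1 - χ ((p : ℕ) : ZMod q) * (p : ℂ) ^ (-s))) *
    ((primesUpTo X).filter (fun p : ℕ => Real.sqrt X < (p : ℝ))).prod
      (fun p : ℕ => 1 - χ ((p : ℕ) : ZMod q) * (p : ℂ) ^ (-s)
        + χ ((p : ℕ) : ZMod q) ^ 2 / (2 * (p : ℂ) ^ (2 * s)))

/-- `𝓠_X^ℓ(s) = ∏_χ Q_X(s,χ)^{ℓ_χ}`. -/
def QXl {q : ℕ} (X : ℝ) (ℓ : DirichletCharacter ℂ q → ℕ) (s : ℂ) : ℂ :=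
  ∏ χ : DirichletCharacter ℂ q, (QX X χ s) ^ (ℓ χ)

/-- `𝓛^ℓ(s) = ∏_χ L(s,χ)^{ℓ_χ}`. -/
def Ll {q : ℕ} [NeZero q] (ℓ : DirichletCharacter ℂ q → ℕ) (s : ℂ) : ℂ :=
  ∏ χ : DirichletCharacter ℂ q, (DirichletCharacter.LFunction χ s) ^ (ℓ χ)

/-- GRH for the Dirichlet L-functions modulo `q`: every zero `ρ` of `L(s,χ)` with
`0 < Re ρ < 1` satisfies `Re ρ = 1/2`. -/
def GRHmod (q : ℕ) [NeZero q] : Prop :=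
  ∀ χ : DirichletCharacter ℂ q, ∀ ρ : ℂ,
    DirichletCharacter.LFunction χ ρ = 0 → 0 < ρ.re → ρ.re < 1 → ρ.re = 1 / 2

end

noncomputable section

/-- The `p`-th local factor of `Q_X(s,χ)` as a function of `w = χ(p)p^{-s}`. -/
def localFactor (X : ℝ) (p : ℕ) (w : ℂ) : ℂ :=
  if (p : ℝ) ≤ Real.sqrt X then 1 - w else 1 - w + w ^ 2 / 2

/-- The sum of `w ^ j / j` over the `j ≥ 1` with `p ^ j ≤ X`. -/
def localSum (X : ℝ) (p : ℕ) (w : ℂ) : ℂ :=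
  ∑ j ∈ Finset.Icc 1 (Nat.log p ⌊X⌋₊), w ^ j / j

/-- The value `χ*(p)p^{-s}`, where `χ*` is the primitive character inducing `χ`. -/
def primitiveTerm {q : ℕ} (χ : DirichletCharacter ℂ q) (s : ℂ) (p : ℕ) : ℂ :=
  χ.primitiveCharacter ((p : ℕ) : ZMod χ.conductor) * (p : ℂ) ^ (-s)

lemma mem_primesUpTo {X : ℝ} {p : ℕ} :
    p ∈ primesUpTo X ↔ p.Prime ∧ (p : ℝ) ≤ X := by
  simp only [primesUpTo, Finset.mem_filter, Finset.mem_range, Nat.lt_succ_iff]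
  exact ⟨fun h => h.2, fun h => ⟨Nat.le_floor h.2, h⟩⟩

lemma pow_le_mul_rpow {X w : ℝ} {p N : ℕ} (hX : 0 < X) (hp : 2 ≤ p) (hN : 3 ≤ N)
    (hpN : X ≤ (p : ℝ) ^ N) (hw0 : 0 ≤ w) (hw : w ≤ (p : ℝ) ^ (-(1 / 2) : ℝ)) :
    w ^ N ≤ X ^ (-(1 / 12) : ℝ) * (p : ℝ) ^ (-(5 / 4) : ℝ) := by
  have hp1 : (1 : ℝ) ≤ p := by exact_mod_cast (by omega : 1 ≤ p)
  have hp0 : (0 : ℝ) < p := by linarith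
  have hN' : (3 : ℝ) ≤ N := by exact_mod_cast hN
  calc w ^ N ≤ ((p : ℝ) ^ (-(1 / 2) : ℝ)) ^ N := pow_le_pow_left₀ hw0 hw N
    _ = ((p : ℝ) ^ N) ^ (-(1 / 12) : ℝ) * (p : ℝ) ^ (-(5 / 12) * N : ℝ) := by
      rw [← Real.rpow_natCast, ← Real.rpow_natCast, ← Real.rpow_mul hp0.le,
        ← Real.rpow_mul hp0.le, ← Real.rpow_add hp0]
      congr 1
      ring
    _ ≤ _ := by
      gcongr ?_ * ?_
      · exact Real.rpow_le_rpow_of_nonpos hX hpN (by norm_num)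
      · exact Real.rpow_le_rpow_of_exponent_le hp1 (by linarith)

lemma norm_le_of_norm_le_rpow {w : ℂ} {p : ℕ} (hp : 2 ≤ p)
    (hw : ‖w‖ ≤ (p : ℝ) ^ (-(1 / 2) : ℝ)) : ‖w‖ ≤ 71 / 100 := by
  have hp2 : (2 : ℝ) ≤ p := by exact_mod_cast hp
  have h : ‖w‖ ^ 2 ≤ (p : ℝ)⁻¹ := by
    calc ‖w‖ ^ 2 ≤ ((p : ℝ) ^ (-(1 / 2) : ℝ)) ^ 2 := pow_le_pow_left₀ (norm_nonneg _) hw 2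
      _ = _ := by
        rw [← Real.rpow_natCast, ← Real.rpow_mul (by positivity)]
        norm_num [Real.rpow_neg_one]
  have h2 : (p : ℝ)⁻¹ ≤ 2⁻¹ := by gcongr
  nlinarith [norm_nonneg w]

lemma le_norm_one_sub {w : ℂ} (hw : ‖w‖ ≤ 71 / 100) : 29 / 100 ≤ ‖1 - w‖ := by
  have := norm_sub_norm_le (1 : ℂ) w
  rw [norm_one] at this
  linarith

lemma le_norm_one_sub_add_sq {w : ℂ} (hw : ‖w‖ ≤ 71 / 100) :
    37 / 1000 ≤ ‖1 - w + w ^ 2 / 2‖ := by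
  have h1 := norm_sub_norm_le (1 - w) (-(w ^ 2 / 2))
  rw [sub_neg_eq_add, norm_neg, norm_div, norm_pow, Complex.norm_ofNat] at h1
  have h2 := le_norm_one_sub hw
  nlinarith [norm_nonneg w]

lemma localFactor_ne_zero {X : ℝ} {p : ℕ} {w : ℂ} (hw : ‖w‖ ≤ 71 / 100) :
    localFactor X p w ≠ 0 := by
  have h1 := le_norm_one_sub hw
  have h2 := le_norm_one_sub_add_sq hw
  unfold localFactor
  split_ifs <;> rw [← norm_pos_iff] <;> linarith

lemma localSum_eq_neg_logTaylor (X : ℝ) (p : ℕ) (w : ℂ) :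
    localSum X p w = -logTaylor (Nat.log p ⌊X⌋₊ + 1) (-w) := by
  have hsub : Finset.Icc 1 (Nat.log p ⌊X⌋₊) ⊆ Finset.range (Nat.log p ⌊X⌋₊ + 1) := by
    intro j hj
    simp only [Finset.mem_Icc, Finset.mem_range] at hj ⊢
    omega
  rw [localSum, logTaylor, ← Finset.sum_neg_distrib]
  refine (Finset.sum_congr rfl fun j _ => ?_).trans (Finset.sum_subset hsub fun j hj hj' => ?_)
  · rw [pow_succ, mul_neg_one, neg_mul, neg_div, neg_neg, ← mul_pow, neg_one_mul, neg_neg]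
  · have : j = 0 := by
      simp only [Finset.mem_Icc, Finset.mem_range] at hj hj'
      omega
    simp [this]

lemma norm_localFactor_inv_mul_exp_sub_one_le {X : ℝ} (hX : 1 < X) {p : ℕ} (hp : p.Prime)
    (hpX : (p : ℝ) ≤ X) {w : ℂ} (hw : ‖w‖ ≤ (p : ℝ) ^ (-(1 / 2) : ℝ)) :
    ‖(localFactor X p w)⁻¹ * cexp (-localSum X p w) - 1‖ ≤
      7 * (X ^ (-(1 / 12) : ℝ) * (p : ℝ) ^ (-(5 / 4) : ℝ)) := by
  have hX0 : 0 < X := by linarith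
  have hw1 := norm_le_of_norm_le_rpow hp.two_le hw
  have hp1 : (1 : ℝ) < p := by exact_mod_cast hp.one_lt
  by_cases h : (p : ℝ) ≤ Real.sqrt X
  · have hp2 : (p : ℝ) ^ 2 ≤ X := (Real.le_sqrt' (by positivity)).1 h
    set J := Nat.log p ⌊X⌋₊ with hJ
    have hJ2 : 2 ≤ J := Nat.le_log_of_pow_le hp.one_lt (Nat.le_floor (by exact_mod_cast hp2))
    have hXJ : X ≤ (p : ℝ) ^ (J + 1) := by
      have := Nat.lt_pow_succ_log_self hp.one_lt ⌊X⌋₊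
      exact_mod_cast ((Nat.floor_lt hX0.le).1 this).le
    have ha := pow_le_mul_rpow hX0 hp.two_le (by omega : 3 ≤ J + 1) hXJ (norm_nonneg w) hw
    set t := log (1 - w)⁻¹ + logTaylor (J + 1) (-w) with ht
    have hne : 1 - w ≠ 0 := by
      have := le_norm_one_sub hw1
      rw [← norm_pos_iff]; linarith
    have hbound : ‖t‖ ≤ 3 / 2 * ‖w‖ ^ (J + 1) := by
      have hJ3 : (2 : ℝ) ≤ J := by exact_mod_cast hJ2
      refine (norm_log_one_sub_inv_add_logTaylor_neg_le J (by linarith)).trans ?_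
      rw [div_le_iff₀ (by linarith), mul_right_comm, mul_comm]
      refine mul_le_mul_of_nonneg_right ?_ (by positivity)
      rw [inv_le_comm₀ (by linarith) (by linarith)]
      have : (3 / 2 * (J + 1) : ℝ)⁻¹ ≤ (9 / 2 : ℝ)⁻¹ := by gcongr; linarith
      linarith
    have hw3 : ‖w‖ ^ (J + 1) ≤ 1 / 2 := by
      calc ‖w‖ ^ (J + 1) ≤ ‖w‖ ^ 3 :=
            pow_le_pow_of_le_one (norm_nonneg w) (by linarith) (by omega)
        _ ≤ (71 / 100) ^ 3 := by gcongr
        _ ≤ _ := by norm_num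
    have heq : (localFactor X p w)⁻¹ * cexp (-localSum X p w) = cexp t := by
      rw [localFactor, if_pos h, localSum_eq_neg_logTaylor, neg_neg, ht, Complex.exp_add,
        Complex.exp_log (inv_ne_zero hne)]
    rw [heq]
    have := norm_exp_sub_one_le (x := t) (by linarith)
    have : 0 ≤ ‖w‖ ^ (J + 1) := by positivity
    linarith
  · have hp2 : X < (p : ℝ) ^ 2 := by
      rw [not_le, Real.sqrt_lt' (by positivity)] at h
      exact h
    have hJ : Nat.log p ⌊X⌋₊ = 1 := by
      rw [Nat.log_eq_iff (by simp)]
      refine ⟨Nat.le_floor (by simpa using hpX), (Nat.floor_lt hX0.le).2 (by exact_mod_cast hp2)⟩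
    have ha := pow_le_mul_rpow hX0 hp.two_le le_rfl
      (hp2.le.trans (pow_le_pow_right₀ hp1.le (by norm_num))) (norm_nonneg w) hw
    have hne := localFactor_ne_zero (X := X) (p := p) hw1
    have hge := le_norm_one_sub_add_sq hw1
    have hexp := Complex.exp_bound (x := -w) (by rw [norm_neg]; linarith) (n := 3) (by norm_num)
    rw [localFactor, if_neg h] at hne ⊢
    have hS : localSum X p w = w := by simp [localSum, hJ]
    rw [hS]
    have heq : (1 - w + w ^ 2 / 2)⁻¹ * cexp (-w) - 1 =
        (1 - w + w ^ 2 / 2)⁻¹ * (cexp (-w) - (1 - w + w ^ 2 / 2)) := by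
      rw [mul_sub, inv_mul_cancel₀ hne]
    rw [heq, norm_mul, norm_inv]
    have hsum : ∑ m ∈ Finset.range 3, (-w) ^ m / (m.factorial : ℂ) = 1 - w + w ^ 2 / 2 := by
      simp [Finset.sum_range_succ, Nat.factorial]
      ring
    rw [hsum, norm_neg] at hexp
    norm_num [Nat.factorial] at hexp
    rw [inv_mul_le_iff₀ (by linarith)]
    have : 0 ≤ ‖w‖ ^ 3 := by positivity
    nlinarith

lemma norm_mul_sub_one_le_exp {x y : ℂ} {a b : ℝ} (hx : ‖x - 1‖ ≤ Real.exp a - 1)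
    (hy : ‖y - 1‖ ≤ Real.exp b - 1) : ‖x * y - 1‖ ≤ Real.exp (a + b) - 1 := by
  have h : x * y - 1 = (x - 1) * (y - 1) + (x - 1) + (y - 1) := by ring
  have := norm_add₃_le (a := (x - 1) * (y - 1)) (b := x - 1) (c := y - 1)
  rw [← h, norm_mul] at this
  rw [Real.exp_add]
  nlinarith [norm_nonneg (x - 1), norm_nonneg (y - 1)]

lemma norm_prod_sub_one_le_exp {ι : Type*} (s : Finset ι) (f : ι → ℂ) (a : ι → ℝ)
    (h : ∀ i ∈ s, ‖f i - 1‖ ≤ Real.exp (a i) - 1) :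
    ‖∏ i ∈ s, f i - 1‖ ≤ Real.exp (∑ i ∈ s, a i) - 1 := by
  induction s using Finset.induction_on with
  | empty => simp
  | insert i s hi ih =>
    rw [Finset.prod_insert hi, Finset.sum_insert hi]
    exact norm_mul_sub_one_le_exp (h i (by simp)) (ih fun j hj => h j (by simp [hj]))

lemma norm_pow_sub_one_le_exp {x : ℂ} {a : ℝ} (hx : ‖x - 1‖ ≤ Real.exp a - 1) (n : ℕ) :
    ‖x ^ n - 1‖ ≤ Real.exp (n * a) - 1 := by
  simpa using norm_prod_sub_one_le_exp (Finset.range n) (fun _ => x) (fun _ => a) fun _ _ => hx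

lemma norm_primitiveTerm_le {q : ℕ} (χ : DirichletCharacter ℂ q) {s : ℂ} (hs : 1 / 2 ≤ s.re)
    {p : ℕ} (hp : p.Prime) : ‖primitiveTerm χ s p‖ ≤ (p : ℝ) ^ (-(1 / 2) : ℝ) := by
  rw [primitiveTerm, norm_mul, Complex.norm_natCast_cpow_of_pos hp.pos, neg_re]
  have h1 := DirichletCharacter.norm_le_one χ.primitiveCharacter ((p : ℕ) : ZMod χ.conductor)
  have h2 : (p : ℝ) ^ (-s.re) ≤ (p : ℝ) ^ (-(1 / 2) : ℝ) :=
    Real.rpow_le_rpow_of_exponent_le (by exact_mod_cast hp.one_le) (by linarith)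
  calc _ ≤ 1 * (p : ℝ) ^ (-s.re) := by gcongr
    _ ≤ _ := by rwa [one_mul]

lemma sum_vonMangoldt_eq_sum_localSum {q : ℕ} (χ : DirichletCharacter ℂ q) (s : ℂ) {X : ℝ}
    (hX : 1 < X) :
    ∑ n ∈ natsUpTo X, χ.primitiveCharacter ((n : ℕ) : ZMod χ.conductor) * (Λ n : ℂ) /
        ((n : ℂ) ^ s * (Real.log n : ℂ)) =
      ∑ p ∈ primesUpTo X, localSum X p (primitiveTerm χ s p) := by
  have hX0 : 0 ≤ X := by linarith
  have hXf : ⌊X⌋₊ ≠ 0 := (Nat.floor_pos.mpr hX.le).ne'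
  simp only [localSum]
  rw [Finset.sum_sigma']
  symm
  refine Finset.sum_of_injOn (fun x : (_ : ℕ) × ℕ => x.1 ^ x.2) ?_ ?_ ?_ ?_
  · rintro ⟨p, i⟩ hp ⟨r, j⟩ hr h
    simp only [Finset.coe_sigma, Set.mem_sigma_iff, Finset.mem_coe, Finset.mem_Icc,
      mem_primesUpTo] at hp hr h
    obtain ⟨rfl, rfl⟩ := Nat.Prime.pow_inj' hp.1.1 hr.1.1 (by omega) (by omega) h
    rfl
  · rintro ⟨p, i⟩ hp
    simp only [Finset.coe_sigma, Set.mem_sigma_iff, Finset.mem_coe, Finset.mem_Icc,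
      mem_primesUpTo, natsUpTo, Finset.mem_filter, Finset.mem_range] at hp ⊢
    have h := Nat.pow_le_of_le_log hXf hp.2.2
    exact ⟨by omega, (Nat.le_floor_iff hX0).1 h⟩
  · intro n hn hn'
    have : Λ n = 0 := by
      rw [ArithmeticFunction.vonMangoldt_eq_zero_iff]
      intro hpp
      obtain ⟨p, j, hp, hj, rfl⟩ := (isPrimePow_nat_iff _).1 hpp
      refine hn' ⟨⟨p, j⟩, ?_, rfl⟩
      simp only [natsUpTo, Finset.mem_filter, Finset.mem_range] at hn
      have hle : p ^ j ≤ ⌊X⌋₊ := by omega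
      simp only [Finset.coe_sigma, Set.mem_sigma_iff, Finset.mem_coe, Finset.mem_Icc,
        mem_primesUpTo]
      refine ⟨⟨hp, ?_⟩, hj, Nat.le_log_of_pow_le hp.one_lt hle⟩
      exact (Nat.le_floor_iff hX0).1 ((Nat.le_self_pow hj.ne' p).trans hle)
    simp [this]
  · rintro ⟨p, j⟩ hp
    simp only [Finset.mem_sigma, Finset.mem_Icc, mem_primesUpTo] at hp ⊢
    have hpr := hp.1.1
    have hlog : (Real.log p : ℂ) ≠ 0 := by
      have : 0 < Real.log p := Real.log_pos (by exact_mod_cast hpr.one_lt)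
      exact_mod_cast this.ne'
    have hj : (j : ℂ) ≠ 0 := by
      have : j ≠ 0 := by omega
      exact_mod_cast this
    rw [ArithmeticFunction.vonMangoldt_apply_pow (by omega),
      ArithmeticFunction.vonMangoldt_apply_prime hpr, primitiveTerm, mul_pow, ← map_pow,
      Complex.cpow_neg]
    have hpow : ((p ^ j : ℕ) : ℂ) ^ s = ((p : ℂ) ^ s) ^ j := by
      rw [← Complex.cpow_nat_mul, Complex.natCast_cpow_natCast_mul, Nat.cast_pow]
    rw [hpow, Nat.cast_pow, Nat.cast_pow, Real.log_pow, Complex.ofReal_mul,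
      Complex.ofReal_natCast, inv_pow]
    field_simp

lemma PX_eq_prod {q : ℕ} [NeZero q] (χ : DirichletCharacter ℂ q) (s : ℂ) {X : ℝ}
    (hX : (q : ℝ) ^ 2 < X) :
    PX X χ s = ∏ p ∈ primesUpTo X,
      ((if p ∣ q then localFactor X p (primitiveTerm χ s p) else 1) *
        cexp (localSum X p (primitiveTerm χ s p))) := by
  have hq : 0 < q := Nat.pos_of_ne_zero (NeZero.ne q)
  have hq1 : (1 : ℝ) ≤ q := by exact_mod_cast hq
  have hX1 : 1 < X := by nlinarith
  rw [PX, sum_vonMangoldt_eq_sum_localSum χ s hX1, Complex.exp_sum, Finset.prod_mul_distrib]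
  congr 1
  rw [← Finset.prod_filter]
  have hset : (primesUpTo X).filter (· ∣ q) = q.primeFactors := by
    ext p
    simp only [Finset.mem_filter, mem_primesUpTo, Nat.mem_primeFactors]
    refine ⟨fun h => ⟨h.1.1, h.2, hq.ne'⟩, fun h => ⟨⟨h.1, ?_⟩, h.2.1⟩⟩
    have : (p : ℝ) ≤ q := by exact_mod_cast Nat.le_of_dvd hq h.2.1
    nlinarith
  rw [hset]
  refine Finset.prod_congr rfl fun p hp => ?_
  have : (p : ℝ) ≤ q := by exact_mod_cast Nat.le_of_mem_primeFactors hp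
  rw [localFactor, if_pos, primitiveTerm]
  exact this.trans (Real.le_sqrt_of_sq_le hX.le)

lemma QX_eq_prod {q : ℕ} [NeZero q] (χ : DirichletCharacter ℂ q) (s : ℂ) {X : ℝ}
    (hX : (q : ℝ) ^ 2 < X) :
    QX X χ s = ∏ p ∈ primesUpTo X,
      if p ∣ q then 1 else localFactor X p (primitiveTerm χ s p) := by
  have hX0 : 0 ≤ X := (by positivity : (0 : ℝ) ≤ (q : ℝ) ^ 2).trans hX.le
  have hlocal : ∀ p ∈ primesUpTo X, (if p ∣ q then 1 else localFactor X p (primitiveTerm χ s p)) =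
      localFactor X p (χ ((p : ℕ) : ZMod q) * (p : ℂ) ^ (-s)) := by
    intro p hp
    rw [mem_primesUpTo] at hp
    split_ifs with h
    · have h0 : χ ((p : ℕ) : ZMod q) = 0 := by
        refine MulChar.map_nonunit χ fun hu => ?_
        rw [ZMod.isUnit_iff_coprime, hp.1.coprime_iff_not_dvd] at hu
        exact hu h
      simp [localFactor, h0]
    · have := χ.primitiveCharacter_apply_of_isCoprime (a := (p : ℤ))
        (Nat.isCoprime_iff_coprime.2 (hp.1.coprime_iff_not_dvd.2 h))
      simp only [Int.cast_natCast] at this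
      rw [primitiveTerm, this]
  rw [Finset.prod_congr rfl hlocal, QX]
  simp only [localFactor]
  rw [Finset.prod_ite]
  congr 1
  simp only [not_le]
  refine Finset.prod_congr rfl fun p _ => ?_
  rw [mul_pow, Complex.cpow_neg, inv_pow, ← Complex.cpow_nat_mul, Nat.cast_two,
    ← div_eq_mul_inv, ← div_eq_mul_inv, div_div, mul_comm ((p : ℂ) ^ (2 * s))]

lemma inv_PX_eq {q : ℕ} [NeZero q] (χ : DirichletCharacter ℂ q) {s : ℂ} (hs : 1 / 2 ≤ s.re)
    {X : ℝ} (hX : (q : ℝ) ^ 2 < X) :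
    (PX X χ s)⁻¹ = QX X χ s * ∏ p ∈ primesUpTo X, (localFactor X p (primitiveTerm χ s p))⁻¹ *
      cexp (-localSum X p (primitiveTerm χ s p)) := by
  have hX0 : 0 ≤ X := (by positivity : (0 : ℝ) ≤ (q : ℝ) ^ 2).trans hX.le
  rw [PX_eq_prod χ s hX, QX_eq_prod χ s hX, ← Finset.prod_mul_distrib, ← Finset.prod_inv_distrib]
  refine Finset.prod_congr rfl fun p hp => ?_
  have hpr := (mem_primesUpTo.1 hp).1
  have hne := localFactor_ne_zero (X := X) (p := p)
    (norm_le_of_norm_le_rpow hpr.two_le (norm_primitiveTerm_le χ hs hpr))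
  rw [Complex.exp_neg]
  split_ifs
  · rw [mul_inv, one_mul]
  · rw [one_mul, mul_inv_cancel_left₀ hne]

end

/-- Uniformly for `Re s ≥ 1/2` and `X > q²`,
`[𝓟_X^ℓ(s)]⁻¹ = 𝓠_X^ℓ(s)(1 + O_k(1/log X))`, the implied constant depending only on `k`. -/
theorem PXl_inv_eq_QXl (k : ℕ) :
    ∃ C : ℝ, ∀ (q : ℕ) [NeZero q], ∀ ℓ : DirichletCharacter ℂ q → ℕ,
      (∑ χ : DirichletCharacter ℂ q, ℓ χ = k) →
      ∀ s : ℂ, 1/2 ≤ s.re → ∀ X : ℝ, (q : ℝ) ^ 2 < X →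
        ∃ E : ℂ, ‖E‖ ≤ C / Real.log X ∧ (PXl X ℓ s)⁻¹ = QXl X ℓ s * (1 + E) := by
  set S : ℝ := ∑' n : ℕ, (n : ℝ) ^ (-(5 / 4) : ℝ) with hS
  have hsum : Summable fun n : ℕ => (n : ℝ) ^ (-(5 / 4) : ℝ) :=
    Real.summable_nat_rpow.2 (by norm_num)
  have hS0 : 0 ≤ S := tsum_nonneg fun n => by positivity
  set B : ℝ := k * (7 * S) with hB
  have hB0 : 0 ≤ B := by positivity
  refine ⟨12 * (B * Real.exp B), fun q _ ℓ hℓ s hs X hX => ?_⟩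
  have hq1 : (1 : ℝ) ≤ q := by exact_mod_cast Nat.pos_of_ne_zero (NeZero.ne q)
  have hX1 : 1 < X := by nlinarith
  have hX0 : 0 < X := by linarith
  set ε : ℝ := X ^ (-(1 / 12) : ℝ) with hε
  have hε0 : 0 ≤ ε := by positivity
  have hε1 : ε ≤ 1 := Real.rpow_le_one_of_one_le_of_nonpos hX1.le (by norm_num)
  set G : DirichletCharacter ℂ q → ℂ := fun χ =>
    ∏ p ∈ primesUpTo X, (localFactor X p (primitiveTerm χ s p))⁻¹ *
      cexp (-localSum X p (primitiveTerm χ s p)) with hG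
  have hGle : ∀ χ, ‖G χ - 1‖ ≤ Real.exp (7 * S * ε) - 1 := by
    intro χ
    refine (norm_prod_sub_one_le_exp (primesUpTo X) _
      (fun p : ℕ => 7 * (ε * (p : ℝ) ^ (-(5 / 4) : ℝ))) ?_).trans ?_
    · intro p hp
      rw [mem_primesUpTo] at hp
      refine (norm_localFactor_inv_mul_exp_sub_one_le hX1 hp.1 hp.2
        (norm_primitiveTerm_le χ hs hp.1)).trans ?_
      linarith [Real.add_one_le_exp (7 * (ε * (p : ℝ) ^ (-(5 / 4) : ℝ)))]
    · gcongr
      rw [← Finset.mul_sum, ← Finset.mul_sum, mul_assoc, mul_comm ε]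
      gcongr
      exact hsum.sum_le_tsum _ fun n _ => by positivity
  refine ⟨∏ χ, G χ ^ ℓ χ - 1, ?_, ?_⟩
  · have hE : ‖∏ χ, G χ ^ ℓ χ - 1‖ ≤ Real.exp (B * ε) - 1 := by
      refine (norm_prod_sub_one_le_exp _ _ _ fun χ _ => norm_pow_sub_one_le_exp (hGle χ) (ℓ χ)).trans_eq ?_
      rw [← Finset.sum_mul, ← Nat.cast_sum, hℓ, hB]
      ring_nf
    have hlog : 0 < Real.log X := Real.log_pos hX1
    have hεlog : ε ≤ 12 / Real.log X := by
      have h := Real.log_le_rpow_div hX0.le (by norm_num : (0 : ℝ) < 1 / 12)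
      rw [hε, Real.rpow_neg hX0.le, inv_le_comm₀ (by positivity) (by positivity), inv_div]
      linarith
    have hexp : Real.exp (B * ε) - 1 ≤ B * ε * Real.exp (B * ε) := by
      have h := Real.add_one_le_exp (-(B * ε))
      have h2 := Real.exp_pos (B * ε)
      have h3 : Real.exp (-(B * ε)) * Real.exp (B * ε) = 1 := by rw [← Real.exp_add]; simp
      nlinarith
    calc _ ≤ B * ε * Real.exp (B * ε) := hE.trans hexp
      _ ≤ B * (12 / Real.log X) * Real.exp (B * 1) := by gcongr
      _ = _ := by rw [mul_one]; ring
  · rw [add_sub_cancel, PXl, QXl, ← Finset.prod_mul_distrib, ← Finset.prod_inv_distrib]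
    refine Finset.prod_congr rfl fun χ _ => ?_
    rw [← inv_pow, inv_PX_eq χ hs hX, mul_pow]
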